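/- arXiv:1804.03092 — 9 statements merged into one kernel-verified Lean document; each statement's English description precedes it below -/
import Mathlib

section
/- Let k1, l1, k3, l3 ∈ ℚ with (k1,l1) ≠ (0,0), (k3,l3) ≠ (0,0) and (k3−k1, l3−l1) ≠ (0,0), and set k2 = k3−k1, l2 = l3−l1. Then the frequency resonance condition k1/(k1²+l1²) + k2/(k2²+l2²) = k3/(k3²+l3²) holds if and only if the quintic equation k3(k1²+l1²)² − k1(k3²+l3²)² = 2(k3(k1²+l1²) − k1(k3²+l3²))(k3·k1 + l3·l1) holds. -/
theorem sq_add_sq_ne_zero_of_pair_ne_zero (k l : ℚ) (h : (k, l) ≠ (0, 0)) :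
    k ^ 2 + l ^ 2 ≠ 0 := by
  contrapose! h
  have hk : k ^ 2 = 0 := by linarith [sq_nonneg k, sq_nonneg l]
  have hl : l ^ 2 = 0 := by linarith [sq_nonneg k, sq_nonneg l]
  rw [pow_eq_zero_iff two_ne_zero] at hk hl
  rw [hk, hl]

/-- For nonzero rational wavevectors `(k1,l1)`, `(k3,l3)` and `(k2,l2) = (k3−k1, l3−l1)`,
the Rossby frequency resonance condition is equivalent to the quintic Diophantine
equation. -/
theorem resonance_iff_quintic (k1 l1 k3 l3 : ℚ)
    (h1 : (k1, l1) ≠ (0, 0)) (h3 : (k3, l3) ≠ (0, 0))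
    (h2 : (k3 - k1, l3 - l1) ≠ (0, 0)) :
    (k1 / (k1 ^ 2 + l1 ^ 2)
        + (k3 - k1) / ((k3 - k1) ^ 2 + (l3 - l1) ^ 2)
      = k3 / (k3 ^ 2 + l3 ^ 2))
    ↔ k3 * (k1 ^ 2 + l1 ^ 2) ^ 2 - k1 * (k3 ^ 2 + l3 ^ 2) ^ 2
      = 2 * (k3 * (k1 ^ 2 + l1 ^ 2) - k1 * (k3 ^ 2 + l3 ^ 2)) * (k3 * k1 + l3 * l1) := by
  have hA := sq_add_sq_ne_zero_of_pair_ne_zero k1 l1 h1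
  have hB := sq_add_sq_ne_zero_of_pair_ne_zero _ _ h2
  have hC := sq_add_sq_ne_zero_of_pair_ne_zero k3 l3 h3
  rw [div_add_div _ _ hA hB, div_eq_div_iff (mul_ne_zero hA hB) hC]
  constructor <;> intro h <;> linear_combination -h
end

section
/- Let A, B ∈ ℚ with 3B² − A² − 2B − 1 ≠ 0. Define X = −(−2B + 1 + A² − 3B²)/(−2B − 1 − A² + 3B²), Y = (A² − 3B² − 1)(−2B + 1 + A² − 3B²)/(−2B − 1 − A² + 3B²)², and D = 2(−A + 2B)(−2B + 1 + A² − 3B²)/(−2B − 1 − A² + 3B²)². Then Y² = X³ − 2D·X² + 2D·X − D². -/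
/-- The explicit rational `(A,B)`-parameterisation of the elliptic surface
`Y² = X³ − 2DX² + 2DX − D²`. -/
theorem AB_parameterisation_solves_elliptic (A B : ℚ)
    (hden : 3 * B ^ 2 - A ^ 2 - 2 * B - 1 ≠ 0)
    (X Y D : ℚ)
    (hX : X = -(-2 * B + 1 + A ^ 2 - 3 * B ^ 2) / (-2 * B - 1 - A ^ 2 + 3 * B ^ 2))
    (hY : Y = (A ^ 2 - 3 * B ^ 2 - 1) * (-2 * B + 1 + A ^ 2 - 3 * B ^ 2)
              / (-2 * B - 1 - A ^ 2 + 3 * B ^ 2) ^ 2)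
    (hD : D = 2 * (-A + 2 * B) * (-2 * B + 1 + A ^ 2 - 3 * B ^ 2)
              / (-2 * B - 1 - A ^ 2 + 3 * B ^ 2) ^ 2) :
    Y ^ 2 = X ^ 3 - 2 * D * X ^ 2 + 2 * D * X - D ^ 2 := by
  have hq : -2 * B - 1 - A ^ 2 + 3 * B ^ 2 ≠ 0 := fun h => hden (by linarith)
  subst hX hY hD
  field_simp
  ring
end

section
/- Let X, Y, D ∈ ℚ satisfy Y² = X³ − 2D·X² + 2D·X − D², and suppose Δ := D² + 4D(Y−X) + (X−Y)² ≠ 0. Define A = 2(D² − DX + X² − Y²)/Δ and B = −(D² − X² + Y²)/Δ, and assume 3B² − A² − 2B − 1 ≠ 0. Then the parameterisation formulas X' = −(−2B + 1 + A² − 3B²)/(−2B − 1 − A² + 3B²), Y' = (A² − 3B² − 1)(−2B + 1 + A² − 3B²)/(−2B − 1 − A² + 3B²)², D' = 2(−A + 2B)(−2B + 1 + A² − 3B²)/(−2B − 1 − A² + 3B²)² satisfy X' = X, Y' = Y and D' = D. -/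
/-- The explicit inverse of the `(A,B)`-parameterisation: starting from a point
`(X,Y,D)` on the elliptic surface `Y² = X³ − 2DX² + 2DX − D²` with
`Δ = D² + 4D(Y−X) + (X−Y)² ≠ 0`, the parameters
`A = 2(D² − DX + X² − Y²)/Δ` and `B = −(D² − X² + Y²)/Δ` reproduce `(X,Y,D)`
through the parameterisation formulas. -/
theorem AB_inverse_parameterisation (X Y D : ℚ)
    (hsurf : Y ^ 2 = X ^ 3 - 2 * D * X ^ 2 + 2 * D * X - D ^ 2)
    (hΔ : D ^ 2 + 4 * D * (Y - X) + (X - Y) ^ 2 ≠ 0)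
    (A B : ℚ)
    (hA : A = 2 * (D ^ 2 - D * X + X ^ 2 - Y ^ 2)
              / (D ^ 2 + 4 * D * (Y - X) + (X - Y) ^ 2))
    (hB : B = -(D ^ 2 - X ^ 2 + Y ^ 2)
              / (D ^ 2 + 4 * D * (Y - X) + (X - Y) ^ 2))
    (hden : 3 * B ^ 2 - A ^ 2 - 2 * B - 1 ≠ 0) :
    -(-2 * B + 1 + A ^ 2 - 3 * B ^ 2) / (-2 * B - 1 - A ^ 2 + 3 * B ^ 2) = X ∧
    (A ^ 2 - 3 * B ^ 2 - 1) * (-2 * B + 1 + A ^ 2 - 3 * B ^ 2)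
      / (-2 * B - 1 - A ^ 2 + 3 * B ^ 2) ^ 2 = Y ∧
    2 * (-A + 2 * B) * (-2 * B + 1 + A ^ 2 - 3 * B ^ 2)
      / (-2 * B - 1 - A ^ 2 + 3 * B ^ 2) ^ 2 = D := by
  set Δ := D ^ 2 + 4 * D * (Y - X) + (X - Y) ^ 2 with hΔdef
  have hX : X * (-2 * B - 1 - A ^ 2 + 3 * B ^ 2) = -(-2 * B + 1 + A ^ 2 - 3 * B ^ 2) := by
    rw [hA, hB]
    field_simp
    rw [hΔdef]
    linear_combination 4 * (D ^ 2 + 4 * D * (Y - X) + (X - Y) ^ 2) * hsurf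
  have hY : Y * (-2 * B - 1 - A ^ 2 + 3 * B ^ 2) = -X * (A ^ 2 - 3 * B ^ 2 - 1) := by
    rw [hA, hB]
    field_simp
    rw [hΔdef]
    ring
  have hD : D * (-2 * B - 1 - A ^ 2 + 3 * B ^ 2) = -X * (2 * (-A + 2 * B)) := by
    rw [hA, hB]
    field_simp
    rw [hΔdef]
    ring
  have hQ : -2 * B - 1 - A ^ 2 + 3 * B ^ 2 ≠ 0 := fun h => hden (by linear_combination h)
  refine ⟨?_, ?_, ?_⟩
  · rw [div_eq_iff hQ, hX]
  · rw [div_eq_iff (pow_ne_zero 2 hQ)]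
    linear_combination -(-2 * B - 1 - A ^ 2 + 3 * B ^ 2) * hY + (A ^ 2 - 3 * B ^ 2 - 1) * hX
  · rw [div_eq_iff (pow_ne_zero 2 hQ)]
    linear_combination -(-2 * B - 1 - A ^ 2 + 3 * B ^ 2) * hD + 2 * (-A + 2 * B) * hX
end

section
/- Let A, B ∈ ℚ and suppose the quantities d1 = A² − 3B² − 2B + 1, d2 = A² − 3B² − 1 and d3 = 2(11 − 3A²)B² + (A²+1)² − 16AB + 9B⁴ are all nonzero. Define κ1 = (A² + B(2−3B) + 1)³/(d1·d3), λ3 = (6(A²+A−1)B² − (A+1)²(A²+1) + 4AB − 9B⁴)/(d2·d1), and λ1 = (A² + B(2−3B) + 1)·[A⁶ + 2A⁵ + A⁴(−9B² − 6B + 3) − 4A³(3B² + 2B − 1) + 3A²(3B² + 2B − 1)² + 2A(9B⁴ + 12B³ + 14B² − 4B + 1) − (3B²+1)²(3B² + 6B − 1)]/(d2·d1·d3). Then (κ1² + λ1²)² − κ1(1 + λ3²)² = 2((κ1² + λ1²) − κ1(1 + λ3²))(κ1 + λ3·λ1), i.e. the normalized wavevector (k1/k3, l1/k3, l3/k3)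 = (κ1, λ1, λ3) satisfies the quintic Rossby resonance equation with k3 = 1. -/
/-- The explicit `(A,B)`-parameterisation of the normalized wavevector
components `(κ1, lam1, lam3) = (k1/k3, l1/k3, l3/k3)` solves the quintic Rossby
resonance equation (with `k3` normalized to `1`). -/
theorem AB_parameterisation_solves_quintic (A B : ℚ)
    (d1 d2 d3 κ1 lam1 lam3 : ℚ)
    (hd1 : d1 = A ^ 2 - 3 * B ^ 2 - 2 * B + 1)
    (hd2 : d2 = A ^ 2 - 3 * B ^ 2 - 1)
    (hd3 : d3 = 2 * (11 - 3 * A ^ 2) * B ^ 2 + (A ^ 2 + 1) ^ 2 - 16 * A * B + 9 * B ^ 4)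
    (hd1' : d1 ≠ 0) (hd2' : d2 ≠ 0) (hd3' : d3 ≠ 0)
    (hκ1 : κ1 = (A ^ 2 + B * (2 - 3 * B) + 1) ^ 3 / (d1 * d3))
    (hlam3 : lam3 = (6 * (A ^ 2 + A - 1) * B ^ 2 - (A + 1) ^ 2 * (A ^ 2 + 1)
                  + 4 * A * B - 9 * B ^ 4) / (d2 * d1))
    (hlam1 : lam1 = (A ^ 2 + B * (2 - 3 * B) + 1)
        * (A ^ 6 + 2 * A ^ 5 + A ^ 4 * (-9 * B ^ 2 - 6 * B + 3)
            - 4 * A ^ 3 * (3 * B ^ 2 + 2 * B - 1)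
            + 3 * A ^ 2 * (3 * B ^ 2 + 2 * B - 1) ^ 2
            + 2 * A * (9 * B ^ 4 + 12 * B ^ 3 + 14 * B ^ 2 - 4 * B + 1)
            - (3 * B ^ 2 + 1) ^ 2 * (3 * B ^ 2 + 6 * B - 1))
        / (d2 * d1 * d3)) :
    (κ1 ^ 2 + lam1 ^ 2) ^ 2 - κ1 * (1 + lam3 ^ 2) ^ 2
      = 2 * ((κ1 ^ 2 + lam1 ^ 2) - κ1 * (1 + lam3 ^ 2)) * (κ1 + lam3 * lam1) := by
  set N := A ^ 2 + B * (2 - 3 * B) + 1 with hN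
  set Q := 6 * (A ^ 2 + A - 1) * B ^ 2 - (A + 1) ^ 2 * (A ^ 2 + 1)
    + 4 * A * B - 9 * B ^ 4 with hQ
  set P := A ^ 6 + 2 * A ^ 5 + A ^ 4 * (-9 * B ^ 2 - 6 * B + 3)
    - 4 * A ^ 3 * (3 * B ^ 2 + 2 * B - 1)
    + 3 * A ^ 2 * (3 * B ^ 2 + 2 * B - 1) ^ 2
    + 2 * A * (9 * B ^ 4 + 12 * B ^ 3 + 14 * B ^ 2 - 4 * B + 1)
    - (3 * B ^ 2 + 1) ^ 2 * (3 * B ^ 2 + 6 * B - 1) with hP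
  have hnorm : P ^ 2 + N ^ 4 * d2 ^ 2 = d3 * (Q ^ 2 + d1 ^ 2 * d2 ^ 2) := by
    rw [hP, hN, hQ, hd1, hd2, hd3]; ring
  have hinner : N ^ 2 * d1 * d2 ^ 2 + P * Q
      = -2 * (A - 2 * B) * (Q ^ 2 + d1 ^ 2 * d2 ^ 2) := by
    rw [hP, hN, hQ, hd1, hd2]; ring
  have hdiff : d1 - N = -4 * B := by rw [hN, hd1]; ring
  have hprod : N * d1 - d3 = 16 * B * (A - 2 * B) := by rw [hN, hd1, hd3]; ring
  clear_value N P Q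
  have hs : 1 + lam3 ^ 2 = (Q ^ 2 + d1 ^ 2 * d2 ^ 2) / (d1 ^ 2 * d2 ^ 2) := by
    rw [hlam3]; field_simp; ring
  have hm : κ1 ^ 2 + lam1 ^ 2 = N ^ 2 / d3 * (1 + lam3 ^ 2) := by
    rw [hs, hκ1, hlam1]; field_simp; linear_combination N ^ 2 * hnorm
  have hdot : κ1 + lam3 * lam1
      = -2 * (A - 2 * B) * N / d3 * (1 + lam3 ^ 2) := by
    rw [hs, hκ1, hlam1, hlam3]; field_simp; linear_combination N * hinner
  have hcoef : (N ^ 2 / d3) ^ 2 - κ1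
      = 2 * (N ^ 2 / d3 - κ1) * (-2 * (A - 2 * B) * N / d3) := by
    rw [hκ1]; field_simp
    linear_combination N ^ 3 * hprod + 4 * N ^ 3 * (A - 2 * B) * hdiff
  rw [hdot, hm]
  linear_combination (1 + lam3 ^ 2) ^ 2 * hcoef
end

section
/- Let A, B ∈ ℚ with the denominators d1 = A² − 3B² − 2B + 1, d2 = A² − 3B² − 1 and d3 = 2(11 − 3A²)B² + (A²+1)² − 16AB + 9B⁴ all nonzero, and let κ1 = k1/k3, λ1 = l1/k3, λ3 = l3/k3 be the normalized wavevector components given by the explicit (A,B)-parameterisation of Rossby resonant triads: κ1 = (A² + B(2−3B) + 1)³/(d1·d3), λ3 = (6(A²+A−1)B² − (A+1)²(A²+1) + 4AB − 9B⁴)/(d2·d1), λ1 = (A² + B(2−3B) + 1)·[A⁶ + 2A⁵ + A⁴(−9B² − 6B + 3) − 4A³(3B² + 2B − 1) + 3A²(3B² + 2B − 1)² + 2A(9B⁴ + 12B³ + 14B² − 4B + 1) − (3B²+1)²(3B² + 6B − 1)]/(d2·d1·d3). If the ordering convention 0 < κ1 ≤ 1 − κ1 (i.e. 0 < k1 ≤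 k2 < k3 after normalizing k3 = 1) and λ1 < 0 holds, then −2 ≤ A ≤ 2 and 1/3 − (1/3)√(4 + 3A²) < B < 0. -/
/-- The cubic comparison behind the sign of `l1`: it only involves the scalings of
`|k1|`, `|B|` and `|A|`. -/
lemma two_mul_mul_sq_add_lt (a b p : ℚ) (hb : 0 < b) (hp : 0 < p)
    (h : p ^ 3 ≤ 8 * b * (p ^ 2 + 6 * b * p + 16 * b ^ 2 - 2 * a * (p + 4 * b))) :
    2 * a * ((p + 4 * b) ^ 2 + 16 * b ^ 2) < (p + 4 * b) ^ 3 + 64 * b ^ 3 := by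
  have hpos : 0 < p ^ 3 * ((p + 4 * b) ^ 2 + 32 * b ^ 2) := by positivity
  have hmul := mul_le_mul_of_nonneg_right h
    (by positivity : 0 ≤ (p + 4 * b) ^ 2 + 16 * b ^ 2)
  have hfac : 0 < 8 * b * (p + 4 * b) := by positivity
  refine lt_of_mul_lt_mul_left ?_ hfac.le
  linear_combination hmul + hpos

/-- The numerator of `1 - κ1`. -/
lemma denom_sub_cube (A B : ℚ) :
    (A ^ 2 - 3 * B ^ 2 - 2 * B + 1) *
        (2 * (11 - 3 * A ^ 2) * B ^ 2 + (A ^ 2 + 1) ^ 2 - 16 * A * B + 9 * B ^ 4)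
      - (A ^ 2 + B * (2 - 3 * B) + 1) ^ 3
      = -8 * B * ((A ^ 2 - 3 * B ^ 2 + A - B) ^ 2 + (A - B + 1) ^ 2) := by
  ring

/-- The long factor in the numerator of `l1`. -/
lemma lam_numerator_eq (A B : ℚ) :
    A ^ 6 + 2 * A ^ 5 + A ^ 4 * (-9 * B ^ 2 - 6 * B + 3)
        - 4 * A ^ 3 * (3 * B ^ 2 + 2 * B - 1)
        + 3 * A ^ 2 * (3 * B ^ 2 + 2 * B - 1) ^ 2
        + 2 * A * (9 * B ^ 4 + 12 * B ^ 3 + 14 * B ^ 2 - 4 * B + 1)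
        - (3 * B ^ 2 + 1) ^ 2 * (3 * B ^ 2 + 6 * B - 1)
      = (A ^ 2 - 3 * B ^ 2 - 2 * B + 1) ^ 3
        + 2 * A * ((A ^ 2 - 3 * B ^ 2 - 2 * B + 1) ^ 2 + 16 * B ^ 2) - 64 * B ^ 3 := by
  ring


/-- Under the ordering convention `0 < k1 ≤ k2 < k3` (i.e. `0 < κ1 ≤ 1 − κ1`
after normalizing `k3 = 1`) and `l1 < 0` (i.e. `lam1 < 0`), the parameters
`(A,B)` of the explicit parameterisation of Rossby resonant triads satisfy
`−2 ≤ A ≤ 2` and `1/3 − (1/3)√(4 + 3A²) < B < 0`. -/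
theorem AB_bounded_region (A B : ℚ)
    (d1 d2 d3 κ1 lam1 lam3 : ℚ)
    (hd1 : d1 = A ^ 2 - 3 * B ^ 2 - 2 * B + 1)
    (hd2 : d2 = A ^ 2 - 3 * B ^ 2 - 1)
    (hd3 : d3 = 2 * (11 - 3 * A ^ 2) * B ^ 2 + (A ^ 2 + 1) ^ 2 - 16 * A * B + 9 * B ^ 4)
    (hd1' : d1 ≠ 0) (hd2' : d2 ≠ 0) (hd3' : d3 ≠ 0)
    (hκ1 : κ1 = (A ^ 2 + B * (2 - 3 * B) + 1) ^ 3 / (d1 * d3))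
    (hlam3 : lam3 = (6 * (A ^ 2 + A - 1) * B ^ 2 - (A + 1) ^ 2 * (A ^ 2 + 1)
                  + 4 * A * B - 9 * B ^ 4) / (d2 * d1))
    (hlam1 : lam1 = (A ^ 2 + B * (2 - 3 * B) + 1)
        * (A ^ 6 + 2 * A ^ 5 + A ^ 4 * (-9 * B ^ 2 - 6 * B + 3)
            - 4 * A ^ 3 * (3 * B ^ 2 + 2 * B - 1)
            + 3 * A ^ 2 * (3 * B ^ 2 + 2 * B - 1) ^ 2
            + 2 * A * (9 * B ^ 4 + 12 * B ^ 3 + 14 * B ^ 2 - 4 * B + 1)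
            - (3 * B ^ 2 + 1) ^ 2 * (3 * B ^ 2 + 6 * B - 1))
        / (d2 * d1 * d3))
    (hκpos : 0 < κ1) (horder : κ1 ≤ 1 - κ1) (hlam1neg : lam1 < 0) :
    -2 ≤ A ∧ A ≤ 2 ∧
      (1 / 3 - 1 / 3 * Real.sqrt (4 + 3 * (A : ℝ) ^ 2) < (B : ℝ)) ∧ (B : ℝ) < 0 := by
  have hd3pos : 0 < d3 := by
    have h : d3 = (A ^ 2 - 3 * B ^ 2 - 1) ^ 2 + 4 * (A - 2 * B) ^ 2 := by rw [hd3]; ring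
    exact lt_of_le_of_ne (by rw [h]; positivity) hd3'.symm
  have hdiff := denom_sub_cube A B
  rw [← hd1, ← hd3] at hdiff
  rw [lam_numerator_eq, ← hd1] at hlam1
  obtain ⟨P, hP⟩ : ∃ P, P = A ^ 2 + B * (2 - 3 * B) + 1 := ⟨_, rfl⟩
  obtain ⟨N, hN⟩ : ∃ N, N = d1 ^ 3 + 2 * A * (d1 ^ 2 + 16 * B ^ 2) - 64 * B ^ 3 := ⟨_, rfl⟩
  obtain ⟨M, hM⟩ : ∃ M, M = (A ^ 2 - 3 * B ^ 2 + A - B) ^ 2 + (A - B + 1) ^ 2 := ⟨_, rfl⟩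
  have hM0 : 0 ≤ M := by rw [hM]; positivity
  have hMP : M = P ^ 2 - 6 * B * P + 16 * B ^ 2 + 2 * A * (P - 4 * B) := by
    rw [hM, hP]; ring
  have hdP : d1 = P - 4 * B := by rw [hd1, hP]; ring
  have hd2P : d2 = P - 2 * B - 2 := by rw [hd2, hP]; ring
  rw [← hP] at hκ1 hdiff
  rw [← hP, ← hN] at hlam1
  rw [← hM] at hdiff
  have hhalf : P ^ 3 / (d1 * d3) ≤ 1 / 2 := by linarith
  rw [hκ1] at hκpos
  rw [hlam1] at hlam1neg
  rcases lt_or_gt_of_ne hd1' with h1 | h1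
  · -- Here `P < 0 < B`, and the sign of `l1` is wrong.
    exfalso
    have hneg : d1 * d3 < 0 := mul_neg_of_neg_of_pos h1 hd3pos
    have hP3 : P ^ 3 < 0 := by
      by_contra! h
      exact absurd hκpos (not_lt.mpr (div_nonpos_of_nonneg_of_nonpos h hneg.le))
    have hPneg : P < 0 := by
      by_contra! h
      exact absurd hP3 (not_lt.mpr (by positivity))
    rw [div_le_iff_of_neg hneg] at hhalf
    have hB : 0 < B := by
      by_contra! h
      have := mul_nonneg (neg_nonneg.mpr h) hM0
      linarith
    have hd2neg : d2 < 0 := by linarith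
    have key := two_mul_mul_sq_add_lt A B (-P) hB (by linarith) (by
      rw [hMP] at hdiff
      linarith)
    have hNneg : N < 0 := by
      rw [hN, hdP]
      linarith
    have hnum : 0 < P * N := mul_pos_of_neg_of_neg hPneg hNneg
    have hden : 0 < d2 * d1 * d3 := mul_pos (mul_pos_of_neg_of_neg hd2neg h1) hd3pos
    exact absurd hlam1neg (not_lt.mpr (by positivity))
  · have hpos : 0 < d1 * d3 := mul_pos h1 hd3pos
    have hP3 : 0 < P ^ 3 := (div_pos_iff_of_pos_right hpos).mp hκpos
    have hPpos : 0 < P := by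
      by_contra! h
      exact absurd hP3 (not_lt.mpr (Odd.pow_nonpos (by decide) h))
    rw [div_le_iff₀ hpos] at hhalf
    have hB : B < 0 := by
      by_contra! h
      have := mul_nonneg h hM0
      linarith
    have key := two_mul_mul_sq_add_lt (-A) (-B) P (by linarith) hPpos (by
      rw [hMP] at hdiff
      linarith)
    have hNpos : 0 < N := by
      rw [hN, hdP]
      linarith
    have hd2neg : d2 < 0 := by
      by_contra! h
      exact absurd hlam1neg (not_lt.mpr (by positivity))
    have hB1 : -1 < B := by linarith
    have hA : A ^ 2 ≤ 2 ^ 2 := by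
      have := mul_pos (by linarith : 0 < 1 - B) (by linarith : 0 < 1 + B)
      linarith
    obtain ⟨hA1, hA2⟩ := abs_le_of_sq_le_sq' hA (by norm_num)
    refine ⟨hA1, hA2, ?_, by exact_mod_cast hB⟩
    have hPreal : (0 : ℝ) < (A : ℝ) ^ 2 + B * (2 - 3 * B) + 1 := by
      rw [hP] at hPpos
      exact_mod_cast hPpos
    have hsqrt : 1 - 3 * (B : ℝ) < Real.sqrt (4 + 3 * (A : ℝ) ^ 2) :=
      Real.lt_sqrt_of_sq_lt (by linarith)
    linarith
end

section
/- Let (k1,l1), (k2,l2), (k3,l3) ∈ ℤ² be a Rossby resonant triad in the small-scale limit F=0 (each wavevector nonzero, k1+k2=k3, l1+l2=l3, and k1/(k1²+l1²) + k2/(k2²+l2²) = k3/(k3²+l3²)). If 0 < k1 ≤ k2 < k3 and l1 < 0, then l2 > 0. -/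
/-- For an integer Rossby resonant triad with `0 < k1 ≤ k2 < k3` and `l1 < 0`,
necessarily `l2 > 0`. -/
theorem l2_positive (k1 l1 k2 l2 k3 l3 : ℤ)
    (h1 : (k1, l1) ≠ (0, 0)) (h2 : (k2, l2) ≠ (0, 0)) (h3 : (k3, l3) ≠ (0, 0))
    (hk : k1 + k2 = k3) (hl : l1 + l2 = l3)
    (hres : (k1 : ℚ) / ((k1 : ℚ) ^ 2 + (l1 : ℚ) ^ 2)
            + (k2 : ℚ) / ((k2 : ℚ) ^ 2 + (l2 : ℚ) ^ 2)
          = (k3 : ℚ) / ((k3 : ℚ) ^ 2 + (l3 : ℚ) ^ 2))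
    (hk1pos : 0 < k1) (hk12 : k1 ≤ k2) (hk23 : k2 < k3)
    (hl1 : l1 < 0) :
    l2 > 0 := by
  by_contra! hl2
  have hk1 : (0 : ℚ) < k1 := by exact_mod_cast hk1pos
  have hk2 : (0 : ℚ) < k2 := by exact_mod_cast hk1pos.trans_le hk12
  have hdot : (0 : ℚ) < k1 * k2 + l1 * l2 :=
    add_pos_of_pos_of_nonneg (mul_pos hk1 hk2)
      (mul_nonneg_of_nonpos_of_nonpos (by exact_mod_cast hl1.le) (by exact_mod_cast hl2))
  subst hk hl
  push_cast at hres
  have hlt1 : (k1 : ℚ) / ((k1 + k2 : ℚ) ^ 2 + (l1 + l2 : ℚ) ^ 2)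
      < k1 / ((k1 : ℚ) ^ 2 + (l1 : ℚ) ^ 2) :=
    div_lt_div_of_pos_left hk1 (by positivity)
      (by linarith [sq_nonneg (l2 : ℚ), pow_pos hk2 2])
  have hlt2 : (k2 : ℚ) / ((k1 + k2 : ℚ) ^ 2 + (l1 + l2 : ℚ) ^ 2)
      < k2 / ((k2 : ℚ) ^ 2 + (l2 : ℚ) ^ 2) :=
    div_lt_div_of_pos_left hk2 (by positivity)
      (by linarith [sq_nonneg (l1 : ℚ), pow_pos hk1 2])
  rw [add_div] at hres
  linarith
end

section
/- Let (k1,l1), (k2,l2), (k3,l3) ∈ ℚ² be a Rossby resonant triad in the small-scale limit F=0 (each wavevector nonzero, k1+k2=k3, l1+l2=l3, and k1/(k1²+l1²) + k2/(k2²+l2²) = k3/(k3²+l3²)). If k1 > 0, k2 > 0 and k1²+l1² ≤ k2²+l2², then k1²+l1² ≤ k3²+l3² ≤ k2²+l2², i.e. ‖k1‖ ≤ ‖k3‖ ≤ ‖k2‖. -/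
/-- In a Rossby resonant triad with `k1 > 0`, `k2 > 0` and `‖k1‖ ≤ ‖k2‖`,
the wavevector `k3` has intermediate modulus: `‖k1‖ ≤ ‖k3‖ ≤ ‖k2‖`. -/
theorem k3_intermediate_modulus (k1 l1 k2 l2 k3 l3 : ℚ)
    (h1 : (k1, l1) ≠ (0, 0)) (h2 : (k2, l2) ≠ (0, 0)) (h3 : (k3, l3) ≠ (0, 0))
    (hk : k1 + k2 = k3) (hl : l1 + l2 = l3)
    (hres : k1 / (k1 ^ 2 + l1 ^ 2) + k2 / (k2 ^ 2 + l2 ^ 2)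
          = k3 / (k3 ^ 2 + l3 ^ 2))
    (hk1 : 0 < k1) (hk2 : 0 < k2)
    (h12 : k1 ^ 2 + l1 ^ 2 ≤ k2 ^ 2 + l2 ^ 2) :
    k1 ^ 2 + l1 ^ 2 ≤ k3 ^ 2 + l3 ^ 2 ∧ k3 ^ 2 + l3 ^ 2 ≤ k2 ^ 2 + l2 ^ 2 := by
  have hk3 : 0 < k3 := hk ▸ add_pos hk1 hk2
  have ha : 0 < k1 ^ 2 + l1 ^ 2 := by positivity
  have hb : 0 < k2 ^ 2 + l2 ^ 2 := by positivity
  have hc : 0 < k3 ^ 2 + l3 ^ 2 := by positivity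
  replace hres : k1 / (k1 ^ 2 + l1 ^ 2) + k2 / (k2 ^ 2 + l2 ^ 2)
      = k1 / (k3 ^ 2 + l3 ^ 2) + k2 / (k3 ^ 2 + l3 ^ 2) := by
    rw [hres, ← add_div, hk]
  generalize k1 ^ 2 + l1 ^ 2 = a at *
  generalize k2 ^ 2 + l2 ^ 2 = b at *
  generalize k3 ^ 2 + l3 ^ 2 = c at *
  constructor
  · by_contra! hca
    have hcb : c < b := hca.trans_le h12
    exact (add_lt_add (div_lt_div_of_pos_left hk1 hc hca)
      (div_lt_div_of_pos_left hk2 hc hcb)).ne hres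
  · by_contra! hbc
    have hac : a < c := h12.trans_lt hbc
    exact (add_lt_add (div_lt_div_of_pos_left hk1 ha hac)
      (div_lt_div_of_pos_left hk2 hb hbc)).ne' hres
end

section
/- Let (k1,l1), (k2,l2), (k3,l3) ∈ ℤ² be a Rossby resonant triad in the small-scale limit F=0 (each wavevector nonzero, k1+k2=k3, l1+l2=l3, and k1/(k1²+l1²) + k2/(k2²+l2²) = k3/(k3²+l3²)), with the ordering convention 0 < k1 < k3, 0 < k2 < k3 and ‖k1‖ ≤ ‖k3‖ ≤ ‖k2‖, where ‖kⱼ‖ = √(kⱼ²+lⱼ²). Then k3 ≤ ‖k3‖ ≤ ‖k1‖ · √(2‖k1‖/k1). -/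
/-- If `v₁ + v₂ = v₃` and `k₁/a + k₂/b = k₃/c`, where `a, b, c` are the squared norms of
`v₁, v₂, v₃`, then `k₁² b c ≤ a³`. -/
theorem sq_mul_norms_le_cube_of_resonant {k1 l1 k2 l2 k3 l3 a b c : ℝ}
    (hk : k1 + k2 = k3) (hl : l1 + l2 = l3)
    (ha : a = k1 ^ 2 + l1 ^ 2) (hb : b = k2 ^ 2 + l2 ^ 2) (hc : c = k3 ^ 2 + l3 ^ 2)
    (ha0 : 0 < a) (hb0 : 0 < b) (hc0 : 0 < c)
    (hres : k1 / a + k2 / b = k3 / c) : k1 ^ 2 * (b * c) ≤ a ^ 3 := by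
  have hcleared : k1 * (b * c) = a * (k3 * b - k2 * c) := by
    field_simp at hres
    linear_combination hres
  have hnorm : (k3 * b - k2 * c) ^ 2 + (l3 * b - l2 * c) ^ 2 = b * c * a := by
    subst hk hl ha hb hc
    ring
  have hle : (k1 ^ 2 * (b * c)) * (b * c) ≤ a ^ 3 * (b * c) := by
    calc (k1 ^ 2 * (b * c)) * (b * c) = (k1 * (b * c)) ^ 2 := by ring
      _ = a ^ 2 * (k3 * b - k2 * c) ^ 2 := by rw [hcleared]; ring
      _ ≤ a ^ 2 * (b * c * a) := by
        gcongr
        linarith [sq_nonneg (l3 * b - l2 * c)]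
      _ = a ^ 3 * (b * c) := by ring
  exact le_of_mul_le_mul_right hle (by positivity)

/-- Practical bound for a Rossby resonant triad:
`k3 ≤ ‖k3‖ ≤ ‖k1‖·√(2‖k1‖/k1)`. -/
theorem practical_bound_k3 (k1 l1 k2 l2 k3 l3 : ℤ)
    (h1 : (k1, l1) ≠ (0, 0)) (h2 : (k2, l2) ≠ (0, 0)) (h3 : (k3, l3) ≠ (0, 0))
    (hk : k1 + k2 = k3) (hl : l1 + l2 = l3)
    (hres : (k1 : ℚ) / ((k1 : ℚ) ^ 2 + (l1 : ℚ) ^ 2)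
            + (k2 : ℚ) / ((k2 : ℚ) ^ 2 + (l2 : ℚ) ^ 2)
          = (k3 : ℚ) / ((k3 : ℚ) ^ 2 + (l3 : ℚ) ^ 2))
    (hk1 : 0 < k1) (hk13 : k1 < k3) (hk2 : 0 < k2) (hk23 : k2 < k3)
    (n1 n2 n3 : ℝ)
    (hn1 : n1 = Real.sqrt ((k1 : ℝ) ^ 2 + (l1 : ℝ) ^ 2))
    (hn2 : n2 = Real.sqrt ((k2 : ℝ) ^ 2 + (l2 : ℝ) ^ 2))
    (hn3 : n3 = Real.sqrt ((k3 : ℝ) ^ 2 + (l3 : ℝ) ^ 2))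
    (hord : n1 ≤ n3 ∧ n3 ≤ n2) :
    (k3 : ℝ) ≤ n3 ∧ n3 ≤ n1 * Real.sqrt (2 * n1 / (k1 : ℝ)) := by
  have hk1R : (0 : ℝ) < k1 := by exact_mod_cast hk1
  have hk2R : (0 : ℝ) < k2 := by exact_mod_cast hk2
  have hk3R : (0 : ℝ) < k3 := by exact_mod_cast hk1.trans hk13
  have hp1 : 0 < n1 := by rw [hn1]; positivity
  have hp2 : 0 < n2 := by rw [hn2]; positivity
  have hp3 : 0 < n3 := by rw [hn3]; positivity
  have hs1 : n1 ^ 2 = (k1 : ℝ) ^ 2 + (l1 : ℝ) ^ 2 := by rw [hn1, Real.sq_sqrt (by positivity)]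
  have hs2 : n2 ^ 2 = (k2 : ℝ) ^ 2 + (l2 : ℝ) ^ 2 := by rw [hn2, Real.sq_sqrt (by positivity)]
  have hs3 : n3 ^ 2 = (k3 : ℝ) ^ 2 + (l3 : ℝ) ^ 2 := by rw [hn3, Real.sq_sqrt (by positivity)]
  have hresR : (k1 : ℝ) / n1 ^ 2 + k2 / n2 ^ 2 = k3 / n3 ^ 2 := by
    rw [hs1, hs2, hs3]
    exact_mod_cast congrArg (fun q : ℚ => (q : ℝ)) hres
  have hcube := sq_mul_norms_le_cube_of_resonant (by exact_mod_cast hk) (by exact_mod_cast hl)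
    hs1 hs2 hs3 (by positivity) (by positivity) (by positivity) hresR
  have hsq : (k1 * n3 ^ 2) ^ 2 ≤ (n1 ^ 3) ^ 2 := by
    calc ((k1 : ℝ) * n3 ^ 2) ^ 2 = k1 ^ 2 * (n3 ^ 2 * n3 ^ 2) := by ring
      _ ≤ k1 ^ 2 * (n2 ^ 2 * n3 ^ 2) := by gcongr; exact hord.2
      _ ≤ (n1 ^ 2) ^ 3 := hcube
      _ = (n1 ^ 3) ^ 2 := by ring
  have hbound : k1 * n3 ^ 2 ≤ n1 ^ 3 := (abs_le_of_sq_le_sq' hsq (by positivity)).2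
  refine ⟨(abs_le_of_sq_le_sq' (by rw [hs3]; linarith [sq_nonneg (l3 : ℝ)]) hp3.le).2,
    (abs_le_of_sq_le_sq' ?_ (by positivity)).2⟩
  rw [mul_pow, Real.sq_sqrt (by positivity), mul_div_assoc', le_div_iff₀ hk1R]
  linarith [pow_pos hp1 3]
end

section
/- Let (k1,l1), (k2,l2), (k3,l3) ∈ ℤ² be a Rossby resonant triad in the small-scale limit F=0 (each wavevector nonzero, k1+k2=k3, l1+l2=l3, and k1/(k1²+l1²) + k2/(k2²+l2²) = k3/(k3²+l3²)), with the ordering convention 0 < k1 < k3, 0 < k2 < k3 and ‖k1‖ ≤ ‖k3‖ ≤ ‖k2‖, where ‖kⱼ‖ = √(kⱼ²+lⱼ²). Then ‖k2‖ ≤ ‖k1‖ · (1 + √(1 + 2‖k1‖/k1)). -/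
/-- Practical bound for a Rossby resonant triad:
`‖k2‖ ≤ ‖k1‖·(1 + √(1 + 2‖k1‖/k1))`. -/
theorem practical_bound_k2 (k1 l1 k2 l2 k3 l3 : ℤ)
    (h1 : (k1, l1) ≠ (0, 0)) (h2 : (k2, l2) ≠ (0, 0)) (h3 : (k3, l3) ≠ (0, 0))
    (hk : k1 + k2 = k3) (hl : l1 + l2 = l3)
    (hres : (k1 : ℚ) / ((k1 : ℚ) ^ 2 + (l1 : ℚ) ^ 2)
            + (k2 : ℚ) / ((k2 : ℚ) ^ 2 + (l2 : ℚ) ^ 2)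
          = (k3 : ℚ) / ((k3 : ℚ) ^ 2 + (l3 : ℚ) ^ 2))
    (hk1 : 0 < k1) (hk13 : k1 < k3) (hk2 : 0 < k2) (hk23 : k2 < k3)
    (n1 n2 n3 : ℝ)
    (hn1 : n1 = Real.sqrt ((k1 : ℝ) ^ 2 + (l1 : ℝ) ^ 2))
    (hn2 : n2 = Real.sqrt ((k2 : ℝ) ^ 2 + (l2 : ℝ) ^ 2))
    (hn3 : n3 = Real.sqrt ((k3 : ℝ) ^ 2 + (l3 : ℝ) ^ 2))
    (hord : n1 ≤ n3 ∧ n3 ≤ n2) :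
    n2 ≤ n1 * (1 + Real.sqrt (1 + 2 * n1 / (k1 : ℝ))) := by
  obtain ⟨-, h32⟩ := hord
  have p1 : (0 : ℝ) < k1 := by exact_mod_cast hk1
  have p2 : (0 : ℝ) < k2 := by exact_mod_cast hk2
  have p3 : (0 : ℝ) < k3 := by exact_mod_cast hk2.trans hk23
  have s1 : n1 ^ 2 = (k1 : ℝ) ^ 2 + (l1 : ℝ) ^ 2 := by rw [hn1, Real.sq_sqrt (by positivity)]
  have s2 : n2 ^ 2 = (k2 : ℝ) ^ 2 + (l2 : ℝ) ^ 2 := by rw [hn2, Real.sq_sqrt (by positivity)]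
  have s3 : n3 ^ 2 = (k3 : ℝ) ^ 2 + (l3 : ℝ) ^ 2 := by rw [hn3, Real.sq_sqrt (by positivity)]
  have pos1 : 0 < n1 := by rw [hn1]; positivity
  have pos2 : 0 < n2 := by rw [hn2]; positivity
  have pos3 : 0 < n3 := by rw [hn3]; positivity
  have hkR : (k3 : ℝ) = k1 + k2 := by exact_mod_cast hk.symm
  have hlR : (l3 : ℝ) = l1 + l2 := by exact_mod_cast hl.symm
  have hresR : (k1 : ℝ) / n1 ^ 2 + k2 / n2 ^ 2 = k3 / n3 ^ 2 := by
    rw [s1, s2, s3]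
    exact_mod_cast congrArg (Rat.cast : ℚ → ℝ) hres
  have hcleared : (k1 : ℝ) * n2 ^ 2 * (n3 ^ 2 - n1 ^ 2) = k2 * n1 ^ 2 * (n2 ^ 2 - n3 ^ 2) := by
    rw [hkR] at hresR
    field_simp at hresR
    linarith
  have hdot : -((k1 : ℝ) * k2 + l1 * l2) ≤ n1 * n2 := by
    refine neg_le.mp (abs_le_of_sq_le_sq' ?_ (by positivity)).1
    rw [mul_pow, s1, s2]
    linarith [sq_nonneg ((k1 : ℝ) * l2 - l1 * k2)]
  have htri_sq : (n2 - n1) ^ 2 ≤ n3 ^ 2 := by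
    rw [hkR, hlR] at s3
    linarith
  have htri : n2 - n1 ≤ n3 := (abs_le_of_sq_le_sq' htri_sq pos3.le).2
  have hk2n2 : (k2 : ℝ) ≤ n2 := by
    refine (abs_le_of_sq_le_sq' ?_ pos2.le).2
    linarith [sq_nonneg (l2 : ℝ)]
  have hdiff : n2 ^ 2 - n3 ^ 2 ≤ n1 * (2 * n2) := by
    calc n2 ^ 2 - n3 ^ 2 = (n2 - n3) * (n2 + n3) := by ring
      _ ≤ n1 * (2 * n2) := by gcongr <;> linarith
  have hdiff_nonneg : 0 ≤ n2 ^ 2 - n3 ^ 2 := sub_nonneg.mpr (by gcongr)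
  have hprod : (k2 : ℝ) * (n2 ^ 2 - n3 ^ 2) ≤ n2 * (n1 * (2 * n2)) := by gcongr
  have hcubic : (k1 : ℝ) * (n3 ^ 2 - n1 ^ 2) ≤ 2 * n1 ^ 3 := by
    refine le_of_mul_le_mul_left ?_ (pow_pos pos2 2)
    linarith [mul_le_mul_of_nonneg_left hprod (sq_nonneg n1)]
  have hsq : ((n2 - n1) / n1) ^ 2 ≤ 1 + 2 * n1 / (k1 : ℝ) := by
    have hexpand : 1 + 2 * n1 / (k1 : ℝ) = (n1 ^ 2 + 2 * n1 ^ 3 / k1) / n1 ^ 2 := by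
      field_simp
    rw [hexpand, div_pow]
    gcongr
    have := (le_div_iff₀' p1).mpr hcubic
    linarith
  have hroot := (div_le_iff₀' pos1).mp (Real.le_sqrt_of_sq_le hsq)
  linarith
end
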